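/- Fix n, m, q, p ∈ ℕ with q ≥ 1, matrices A ∈ ℝ^{n×n}, B ∈ ℝ^{n×m}, C ∈ ℝ^{q×n} of full row rank, N ∈ ℝ^{p×q}, H := N C, a mean μ₀ ∈ ℝⁿ, and symmetric positive definite matrices Σ₀, Q ∈ ℝ^{n×n}. Define the Kalman covariance recursion: P̂(0) = Σ₀; K(t) = P̂(t) Cᵀ (C P̂(t) Cᵀ)⁻¹, P̄(t) = P̂(t) − K(t) C P̂(t), P̂(t+1) = A P̄(t) Aᵀ + Q. Fix a horizon T ∈ ℕ and, for each 0 ≤ t ≤ T−1, a measurable feedback policy C̄_t : (ℝⁿ)^{t+1} → ℝᵐ for the abstract model. Then there exist measurable policies C_t : (ℝⁿ)^{t+1} → ℝᵐ, 0 ≤ t ≤ T−1, such that the following two measures on (ℝᵖ)^{T+1} coincide: (i) the pushforward of N(μ₀, Σ₀) ⊗ (⨂_{t=1}^{T} N(0, C P̂(t) Cᵀ)) under the map sending (ξ, v) to (H x̄(0), …, H x̄(T)), where x̄(0) = μ₀ + K(0) C (ξ − μ₀), ū(t) = C̄_t(x̄(0), …, x̄(t)), and x̄(t+1) = A x̄(t)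 + B ū(t) + K(t+1) v(t+1); and (ii) the pushforward of N(μ₀, Σ₀) ⊗ (⨂_{t=0}^{T−1} N(0, Q)) under the map sending (ξ, w) to (H x(0), …, H x(T)), where x(0) = ξ, u(t) = C_t(x(0), …, x(t)), and x(t+1) = A x(t) + B u(t) + w(t). -/

import Mathlib

open MeasureTheory ProbabilityTheory Matrix

/-- A measure `μ` on `ℝ^d` is Gaussian with mean `m` and covariance `S` if every
one-dimensional projection `x ↦ a ⬝ᵥ x` pushes it to the one-dimensional Gaussian
`N(a ⬝ᵥ m, aᵀ S a)` (variance `0` giving a Dirac mass). -/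
def IsGaussianVec {d : ℕ} (μ : Measure (Fin d → ℝ)) (m : Fin d → ℝ)
    (S : Matrix (Fin d) (Fin d) ℝ) : Prop :=
  ∀ a : Fin d → ℝ,
    μ.map (fun x => a ⬝ᵥ x) = gaussianReal (a ⬝ᵥ m) (Real.toNNReal (a ⬝ᵥ S.mulVec a))

/-- The a priori Kalman covariance recursion: `P̂ 0 = Σ₀` and
`P̂ (t+1) = A * (P̂ t - P̂ t * Cᵀ * (C * P̂ t * Cᵀ)⁻¹ * C * P̂ t) * Aᵀ + Q`. -/
noncomputable def kalmanPhat {n q : ℕ} (A : Matrix (Fin n) (Fin n) ℝ)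
    (C : Matrix (Fin q) (Fin n) ℝ) (Q S0 : Matrix (Fin n) (Fin n) ℝ) :
    ℕ → Matrix (Fin n) (Fin n) ℝ
  | 0 => S0
  | t + 1 =>
      A * (kalmanPhat A C Q S0 t -
            kalmanPhat A C Q S0 t * Cᵀ * (C * kalmanPhat A C Q S0 t * Cᵀ)⁻¹ *
              (C * kalmanPhat A C Q S0 t)) * Aᵀ + Q

/-- The Kalman gain `K t = P̂ t * Cᵀ * (C * P̂ t * Cᵀ)⁻¹`. -/
noncomputable def kalmanK {n q : ℕ} (A : Matrix (Fin n) (Fin n) ℝ)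
    (C : Matrix (Fin q) (Fin n) ℝ) (Q S0 : Matrix (Fin n) (Fin n) ℝ) (t : ℕ) :
    Matrix (Fin n) (Fin q) ℝ :=
  kalmanPhat A C Q S0 t * Cᵀ * (C * kalmanPhat A C Q S0 t * Cᵀ)⁻¹

/-- State history `(x 0, …, x t)` of the closed-loop recursion
`x 0 = ξ`, `x (s+1) = A * x s + B * pol s (x 0, …, x s) + e s`, where `pol` is a
history-dependent feedback policy and `e` an exogenous noise sequence. -/
def clHist {n m : ℕ} (A : Matrix (Fin n) (Fin n) ℝ) (B : Matrix (Fin n) (Fin m) ℝ)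
    (pol : (t : ℕ) → (Fin (t + 1) → Fin n → ℝ) → Fin m → ℝ)
    (e : ℕ → Fin n → ℝ) (ξ : Fin n → ℝ) : (t : ℕ) → Fin (t + 1) → Fin n → ℝ
  | 0 => fun _ => ξ
  | t + 1 =>
      Fin.snoc (clHist A B pol e ξ t)
        (A.mulVec (clHist A B pol e ξ t (Fin.last t)) +
          B.mulVec (pol t (clHist A B pol e ξ t)) + e t)

/-- State `x t` of the closed-loop recursion. -/
def clState {n m : ℕ} (A : Matrix (Fin n) (Fin n) ℝ) (B : Matrix (Fin n) (Fin m) ℝ)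
    (pol : (t : ℕ) → (Fin (t + 1) → Fin n → ℝ) → Fin m → ℝ)
    (e : ℕ → Fin n → ℝ) (ξ : Fin n → ℝ) (t : ℕ) : Fin n → ℝ :=
  clHist A B pol e ξ t (Fin.last t)

/-- Extension of a finite sequence `Fin T → α` to `ℕ → α` by zero. -/
def extFin {T : ℕ} {α : Type*} [Zero α] (w : Fin T → α) (t : ℕ) : α :=
  if h : t < T then w ⟨t, h⟩ else 0

theorem phat_facts {n q : ℕ}
    (A : Matrix (Fin n) (Fin n) ℝ) (C : Matrix (Fin q) (Fin n) ℝ) (hC : C.rank = q)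
    (S0 Q : Matrix (Fin n) (Fin n) ℝ) (hS0 : S0.PosDef) (hQ : Q.PosDef) (t : ℕ) :
    (kalmanPhat A C Q S0 t).PosDef := by
  have hinj : Function.Injective C.vecMul := by
    rw [Matrix.vecMul_injective_iff, linearIndependent_iff_card_eq_finrank_span]
    have := Matrix.rank_eq_finrank_span_row C
    rw [hC] at this
    simpa [Set.finrank] using this
  induction t with
  | zero => simpa [kalmanPhat] using hS0
  | succ t ih =>
    set P := kalmanPhat A C Q S0 t with hP
    have hM : (C * P * Cᵀ).PosDef := by
      have := ih.mul_mul_conjTranspose_same hinj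
      simpa using this
    have hMu : IsUnit (C * P * Cᵀ).det := (Matrix.isUnit_iff_isUnit_det _).1 hM.isUnit
    have hPt : Pᵀ = P := by simpa [Matrix.IsHermitian] using ih.1
    have hMt : (C * P * Cᵀ)ᵀ = C * P * Cᵀ := by
      simp [Matrix.transpose_mul, hPt, Matrix.mul_assoc]
    have key : P - P * Cᵀ * (C * P * Cᵀ)⁻¹ * (C * P) =
        (1 - P * Cᵀ * (C * P * Cᵀ)⁻¹ * C) * P * (1 - P * Cᵀ * (C * P * Cᵀ)⁻¹ * C)ᵀ := by
      have h1 : (1 - P * Cᵀ * (C * P * Cᵀ)⁻¹ * C)ᵀ = 1 - Cᵀ * ((C * P * Cᵀ)⁻¹ * (C * P)) := by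
        rw [Matrix.transpose_sub, Matrix.transpose_one, Matrix.transpose_mul, Matrix.transpose_mul,
          Matrix.transpose_mul, Matrix.transpose_nonsing_inv, hMt, hPt, Matrix.transpose_transpose]
      rw [h1]
      have h2 : (1 - P * Cᵀ * (C * P * Cᵀ)⁻¹ * C) * P * Cᵀ = 0 := by
        have : P * Cᵀ * (C * P * Cᵀ)⁻¹ * C * P * Cᵀ
          = P * Cᵀ * ((C * P * Cᵀ)⁻¹ * (C * P * Cᵀ)) := by simp only [Matrix.mul_assoc]
        rw [Matrix.sub_mul, Matrix.sub_mul, this, Matrix.nonsing_inv_mul _ hMu]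
        simp
      rw [Matrix.mul_sub, ← Matrix.mul_assoc _ Cᵀ, h2]
      simp [Matrix.sub_mul, Matrix.mul_assoc]
    have hps : (P - P * Cᵀ * (C * P * Cᵀ)⁻¹ * (C * P)).PosSemidef := by
      rw [key]
      have := ih.posSemidef.mul_mul_conjTranspose_same (1 - P * Cᵀ * (C * P * Cᵀ)⁻¹ * C)
      rwa [Matrix.conjTranspose_eq_transpose_of_trivial] at this
    have h3 := hps.mul_mul_conjTranspose_same A
    have h4 := Matrix.PosDef.posSemidef_add h3 hQ
    simpa [kalmanPhat, ← hP] using h4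

theorem CPC_posDef {n q : ℕ}
    (C : Matrix (Fin q) (Fin n) ℝ) (hC : C.rank = q)
    (P : Matrix (Fin n) (Fin n) ℝ) (hP : P.PosDef) :
    (C * P * Cᵀ).PosDef := by
  have hinj : Function.Injective C.vecMul := by
    rw [Matrix.vecMul_injective_iff, linearIndependent_iff_card_eq_finrank_span]
    have := Matrix.rank_eq_finrank_span_row C
    rw [hC] at this
    simpa [Set.finrank] using this
  simpa using hP.mul_mul_conjTranspose_same hinj

/-- One measurement-update step: quadratic-form identity. -/
theorem update_identity {n q : ℕ} (C : Matrix (Fin q) (Fin n) ℝ)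
    (P : Matrix (Fin n) (Fin n) ℝ) (K : Matrix (Fin n) (Fin q) ℝ) (hPt : Pᵀ = P)
    (hK : K * (C * P * Cᵀ) = P * Cᵀ) (a : Fin q → ℝ) (b : Fin n → ℝ) :
    (b + Cᵀ *ᵥ (a - Kᵀ *ᵥ b)) ⬝ᵥ P *ᵥ (b + Cᵀ *ᵥ (a - Kᵀ *ᵥ b)) =
      a ⬝ᵥ (C * P * Cᵀ) *ᵥ a + b ⬝ᵥ (P - K * (C * P)) *ᵥ b := by
  have symP : ∀ x y, x ⬝ᵥ P *ᵥ y = y ⬝ᵥ P *ᵥ x := by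
    intro x y
    rw [Matrix.dotProduct_mulVec, dotProduct_comm, ← Matrix.mulVec_transpose, hPt]
  have hM : ∀ x y, (Cᵀ *ᵥ x) ⬝ᵥ P *ᵥ (Cᵀ *ᵥ y) = x ⬝ᵥ (C * P * Cᵀ) *ᵥ y := by
    intro x y
    rw [← Matrix.mulVec_mulVec, ← Matrix.mulVec_mulVec, Matrix.dotProduct_mulVec x C,
      ← Matrix.mulVec_transpose]
  have symM : ∀ x y, x ⬝ᵥ (C * P * Cᵀ) *ᵥ y = y ⬝ᵥ (C * P * Cᵀ) *ᵥ x := by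
    intro x y
    rw [← hM, symP, hM]
  have hb : ∀ x, b ⬝ᵥ P *ᵥ (Cᵀ *ᵥ x) = (Kᵀ *ᵥ b) ⬝ᵥ (C * P * Cᵀ) *ᵥ x := by
    intro x
    rw [Matrix.mulVec_mulVec, ← hK, ← Matrix.mulVec_mulVec, Matrix.dotProduct_mulVec b K,
      ← Matrix.mulVec_transpose]
  have hb2 : b ⬝ᵥ (K * (C * P)) *ᵥ b = (Kᵀ *ᵥ b) ⬝ᵥ (C * P * Cᵀ) *ᵥ (Kᵀ *ᵥ b) := by
    rw [← hb, symP, ← Matrix.mulVec_mulVec, ← Matrix.mulVec_mulVec, Matrix.dotProduct_mulVec b K,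
      ← Matrix.mulVec_transpose, Matrix.dotProduct_mulVec _ C, ← Matrix.mulVec_transpose]
  rw [Matrix.sub_mulVec, dotProduct_sub, hb2]
  simp only [Matrix.mulVec_add, dotProduct_add, add_dotProduct, hb, hM]
  rw [symP (Cᵀ *ᵥ _) b, hb]
  simp only [Matrix.mulVec_sub, dotProduct_sub, sub_dotProduct]
  rw [symM a (Kᵀ *ᵥ b)]
  ring

/-- A priori estimation error (innovation before applying `C`). -/
noncomputable def priorErr {n q : ℕ} (A : Matrix (Fin n) (Fin n) ℝ)
    (C : Matrix (Fin q) (Fin n) ℝ) (K : ℕ → Matrix (Fin n) (Fin q) ℝ)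
    (d0 : Fin n → ℝ) (w : ℕ → Fin n → ℝ) : ℕ → Fin n → ℝ
  | 0 => d0
  | t + 1 => A *ᵥ (priorErr A C K d0 w t - K t *ᵥ (C *ᵥ priorErr A C K d0 w t)) + w t

theorem adjoint_lemma {n q : ℕ} (A : Matrix (Fin n) (Fin n) ℝ)
    (C : Matrix (Fin q) (Fin n) ℝ) (S0 Q : Matrix (Fin n) (Fin n) ℝ)
    (hPt : ∀ t, (kalmanPhat A C Q S0 t)ᵀ = kalmanPhat A C Q S0 t)
    (hK : ∀ t, kalmanK A C Q S0 t * (C * kalmanPhat A C Q S0 t * Cᵀ) =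
      kalmanPhat A C Q S0 t * Cᵀ)
    (a : ℕ → Fin q → ℝ) (t : ℕ) : ∀ c : Fin n → ℝ,
    ∃ (α : Fin n → ℝ) (β : ℕ → Fin n → ℝ),
      (∀ d0 w, ∑ s ∈ Finset.range t, a s ⬝ᵥ C *ᵥ priorErr A C (kalmanK A C Q S0) d0 w s
          + c ⬝ᵥ priorErr A C (kalmanK A C Q S0) d0 w t =
        α ⬝ᵥ d0 + ∑ s ∈ Finset.range t, β s ⬝ᵥ w s) ∧
      α ⬝ᵥ S0 *ᵥ α + ∑ s ∈ Finset.range t, β s ⬝ᵥ Q *ᵥ β s =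
        ∑ s ∈ Finset.range t, a s ⬝ᵥ (C * kalmanPhat A C Q S0 s * Cᵀ) *ᵥ a s
          + c ⬝ᵥ kalmanPhat A C Q S0 t *ᵥ c := by
  induction t with
  | zero => intro c; exact ⟨c, 0, by simp [priorErr], by simp [kalmanPhat]⟩
  | succ t ih =>
    intro c
    set K := kalmanK A C Q S0 with hKdef
    obtain ⟨α, β, h1, h2⟩ := ih (Aᵀ *ᵥ c + Cᵀ *ᵥ (a t - (K t)ᵀ *ᵥ (Aᵀ *ᵥ c)))
    have hβ : ∀ s ∈ Finset.range t, (if s = t then c else β s) = β s := by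
      intro s hs
      rw [if_neg (Finset.mem_range.1 hs).ne]
    refine ⟨α, fun s => if s = t then c else β s, ?_, ?_⟩
    · intro d0 w
      rw [Finset.sum_range_succ, Finset.sum_range_succ (fun s => (if s = t then c else β s) ⬝ᵥ w s),
        Finset.sum_congr (f := fun s => (if s = t then c else β s) ⬝ᵥ w s)
          (g := fun s => β s ⬝ᵥ w s) rfl (fun s hs => by rw [hβ s hs]),
        ← add_assoc (α ⬝ᵥ d0), ← h1 d0 w]
      simp only [priorErr, if_true]
      set d := priorErr A C K d0 w t
      have e1 : ∀ x, (Aᵀ *ᵥ c) ⬝ᵥ x = c ⬝ᵥ A *ᵥ x := by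
        intro x; rw [Matrix.dotProduct_mulVec, Matrix.mulVec_transpose]
      have e2 : ∀ y (x : Fin n → ℝ), (Cᵀ *ᵥ y) ⬝ᵥ x = y ⬝ᵥ C *ᵥ x := by
        intro y x; rw [Matrix.dotProduct_mulVec, Matrix.mulVec_transpose]
      have e3 : ∀ y (x : Fin q → ℝ), ((K t)ᵀ *ᵥ y) ⬝ᵥ x = y ⬝ᵥ K t *ᵥ x := by
        intro y x; rw [Matrix.dotProduct_mulVec, Matrix.mulVec_transpose]
      simp only [dotProduct_add, add_dotProduct, e2, sub_dotProduct, e3, e1, Matrix.mulVec_sub,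
        dotProduct_sub]
      ring
    · rw [Finset.sum_range_succ, Finset.sum_range_succ,
        Finset.sum_congr (g := fun s => β s ⬝ᵥ Q *ᵥ β s) rfl
          (fun s hs => by simp only [hβ s hs]), ← add_assoc, h2,
        update_identity C _ (K t) (hPt t) (hK t)]
      simp only [if_true, kalmanPhat]
      rw [Matrix.add_mulVec, dotProduct_add, ← Matrix.mulVec_mulVec c _ Aᵀ, ← Matrix.mulVec_mulVec _ A,
        Matrix.dotProduct_mulVec c A, ← Matrix.mulVec_transpose]
      simp only [hKdef, kalmanK]
      ring

theorem gauss_char {d : ℕ} (μ : Measure (Fin d → ℝ)) (m : Fin d → ℝ)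
    (S : Matrix (Fin d) (Fin d) ℝ) (hS : S.PosSemidef) (h : IsGaussianVec μ m S)
    (a : Fin d → ℝ) :
    ∫ x, Complex.exp (((a ⬝ᵥ (x - m) : ℝ) : ℂ) * Complex.I) ∂μ =
      Complex.exp (-(((a ⬝ᵥ S *ᵥ a : ℝ) : ℂ) / 2)) := by
  have hm : Measurable (fun x : Fin d → ℝ => a ⬝ᵥ x) := by
    apply Continuous.measurable
    fun_prop
  have h1 := charFun_gaussianReal (μ := a ⬝ᵥ m) (v := Real.toNNReal (a ⬝ᵥ S *ᵥ a)) 1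
  rw [← h a, charFun_apply_real, integral_map hm.aemeasurable
    (by apply Continuous.aestronglyMeasurable; fun_prop)] at h1
  have h0 : 0 ≤ a ⬝ᵥ S *ᵥ a := by simpa using hS.dotProduct_mulVec_nonneg a
  rw [Real.coe_toNNReal _ h0] at h1
  have : ∀ x : Fin d → ℝ, Complex.exp (((a ⬝ᵥ (x - m) : ℝ) : ℂ) * Complex.I) =
      Complex.exp (-((a ⬝ᵥ m : ℝ) : ℂ) * Complex.I) *
        Complex.exp (((1 : ℝ) : ℂ) * ((a ⬝ᵥ x : ℝ) : ℂ) * Complex.I) := by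
    intro x
    rw [← Complex.exp_add, dotProduct_sub]
    push_cast
    ring_nf
  simp_rw [this]
  rw [integral_const_mul, h1, ← Complex.exp_add]
  push_cast
  ring_nf

theorem prod_char {n d T : ℕ} (γ : Measure (Fin n → ℝ)) [IsProbabilityMeasure γ]
    (m : Fin n → ℝ) (S0 : Matrix (Fin n) (Fin n) ℝ) (hS0 : S0.PosSemidef)
    (hγ : IsGaussianVec γ m S0)
    (ν : Fin T → Measure (Fin d → ℝ)) [∀ i, IsProbabilityMeasure (ν i)]
    (S : Fin T → Matrix (Fin d) (Fin d) ℝ) (hS : ∀ i, (S i).PosSemidef)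
    (hν : ∀ i, IsGaussianVec (ν i) 0 (S i))
    (α : Fin n → ℝ) (β : Fin T → Fin d → ℝ) :
    ∫ z : (Fin n → ℝ) × (Fin T → Fin d → ℝ),
      Complex.exp (((α ⬝ᵥ (z.1 - m) + ∑ i, β i ⬝ᵥ z.2 i : ℝ) : ℂ) * Complex.I)
        ∂(γ.prod (Measure.pi ν)) =
      Complex.exp (-(((α ⬝ᵥ S0 *ᵥ α + ∑ i, β i ⬝ᵥ S i *ᵥ β i : ℝ) : ℂ) / 2)) := by
  have : ∀ z : (Fin n → ℝ) × (Fin T → Fin d → ℝ),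
      Complex.exp (((α ⬝ᵥ (z.1 - m) + ∑ i, β i ⬝ᵥ z.2 i : ℝ) : ℂ) * Complex.I) =
      Complex.exp (((α ⬝ᵥ (z.1 - m) : ℝ) : ℂ) * Complex.I) *
        ∏ i, Complex.exp (((β i ⬝ᵥ (z.2 i - 0) : ℝ) : ℂ) * Complex.I) := by
    intro z
    rw [← Complex.exp_sum, ← Complex.exp_add]
    simp only [sub_zero]
    push_cast
    rw [add_mul, Finset.sum_mul]
  simp_rw [this]
  rw [integral_prod_mul (fun x => Complex.exp (((α ⬝ᵥ (x - m) : ℝ) : ℂ) * Complex.I))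
    (fun y : Fin T → Fin d → ℝ =>
      ∏ i, Complex.exp (((β i ⬝ᵥ (y i - 0) : ℝ) : ℂ) * Complex.I)),
    integral_fintype_prod_eq_prod
      (fun i (y : Fin d → ℝ) => Complex.exp (((β i ⬝ᵥ (y - 0) : ℝ) : ℂ) * Complex.I)),
    gauss_char γ m S0 hS0 hγ]
  simp_rw [fun i => gauss_char (ν i) 0 (S i) (hS i) (hν i) (β i)]
  rw [← Complex.exp_sum, ← Complex.exp_add]
  congr 1
  push_cast
  rw [add_div, neg_add, Finset.sum_neg_distrib, Finset.sum_div]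

theorem dual_repr {q T : ℕ} (L : StrongDual ℝ ((Fin q → ℝ) × (Fin T → Fin q → ℝ))) :
    ∃ a : ℕ → Fin q → ℝ, ∀ v0 v, L (v0, v) = a 0 ⬝ᵥ v0 + ∑ i : Fin T, a (i + 1) ⬝ᵥ v i := by
  have rep : ∀ f : (Fin q → ℝ) →ₗ[ℝ] ℝ, ∃ a : Fin q → ℝ, ∀ x, f x = a ⬝ᵥ x := by
    intro f
    refine ⟨fun i => f fun j => if i = j then 1 else 0, fun x => ?_⟩
    rw [LinearMap.pi_apply_eq_sum_univ]
    simp [dotProduct, mul_comm]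
  obtain ⟨a0, h0⟩ := rep (L.toLinearMap ∘ₗ LinearMap.inl ℝ _ _)
  choose b hb using fun i : Fin T =>
    rep (L.toLinearMap ∘ₗ LinearMap.inr ℝ _ _ ∘ₗ LinearMap.single ℝ (fun _ : Fin T => Fin q → ℝ) i)
  refine ⟨fun t => match t with
    | 0 => a0
    | t + 1 => extFin b t, fun v0 v => ?_⟩
  have e : (v0, v) = LinearMap.inl ℝ (Fin q → ℝ) (Fin T → Fin q → ℝ) v0 +
      ∑ i, LinearMap.inr ℝ (Fin q → ℝ) (Fin T → Fin q → ℝ)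
        (LinearMap.single ℝ (fun _ : Fin T => Fin q → ℝ) i (v i)) := by
    rw [← map_sum]
    simp [Finset.univ_sum_single]
  rw [e, map_add, map_sum]
  congr 1
  · exact h0 v0
  · refine Finset.sum_congr rfl fun i _ => ?_
    simp only [extFin, i.2, dif_pos]
    exact hb i (v i)

theorem law_innov {n q : ℕ}
    (A : Matrix (Fin n) (Fin n) ℝ)
    (C : Matrix (Fin q) (Fin n) ℝ)
    (μ0 : Fin n → ℝ) (S0 Q : Matrix (Fin n) (Fin n) ℝ)
    (hS0 : S0.PosDef) (hQ : Q.PosDef)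
    (hPt : ∀ t, (kalmanPhat A C Q S0 t)ᵀ = kalmanPhat A C Q S0 t)
    (hK : ∀ t, kalmanK A C Q S0 t * (C * kalmanPhat A C Q S0 t * Cᵀ) =
      kalmanPhat A C Q S0 t * Cᵀ)
    (hM : ∀ t, (C * kalmanPhat A C Q S0 t * Cᵀ).PosSemidef)
    (T : ℕ)
    (γ0 : Measure (Fin n → ℝ)) [IsProbabilityMeasure γ0]
    (hγ0 : IsGaussianVec γ0 μ0 S0)
    (γw : Measure (Fin n → ℝ)) [IsProbabilityMeasure γw]
    (hγw : IsGaussianVec γw 0 Q)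
    (ν : Fin T → Measure (Fin q → ℝ)) [∀ i, IsProbabilityMeasure (ν i)]
    (hν : ∀ i : Fin T, IsGaussianVec (ν i) 0 (C * kalmanPhat A C Q S0 (i.1 + 1) * Cᵀ))
    (hm1 : Measurable (fun z : (Fin n → ℝ) × (Fin T → Fin q → ℝ) => (C *ᵥ (z.1 - μ0), z.2)))
    (hm2 : Measurable (fun z : (Fin n → ℝ) × (Fin T → Fin n → ℝ) => (C *ᵥ (z.1 - μ0),
      fun i : Fin T =>
        C *ᵥ priorErr A C (kalmanK A C Q S0) (z.1 - μ0) (extFin z.2) (i + 1)))) :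
    (γ0.prod (Measure.pi ν)).map (fun z => (C *ᵥ (z.1 - μ0), z.2)) =
    (γ0.prod (Measure.pi fun _ : Fin T => γw)).map (fun z => (C *ᵥ (z.1 - μ0),
      fun i : Fin T =>
        C *ᵥ priorErr A C (kalmanK A C Q S0) (z.1 - μ0) (extFin z.2) (i + 1))) := by
  have := Measure.isProbabilityMeasure_map (μ := γ0.prod (Measure.pi ν)) hm1.aemeasurable
  have := Measure.isProbabilityMeasure_map
    (μ := γ0.prod (Measure.pi fun _ : Fin T => γw)) hm2.aemeasurable
  apply Measure.ext_of_charFunDual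
  ext L
  obtain ⟨a, ha⟩ := dual_repr L
  have hc : AEStronglyMeasurable (fun v => Complex.exp ((L v : ℂ) * Complex.I))
      ((γ0.prod (Measure.pi ν)).map (fun z => (C *ᵥ (z.1 - μ0), z.2))) := by
    apply Continuous.aestronglyMeasurable; fun_prop
  have hc' : AEStronglyMeasurable (fun v => Complex.exp ((L v : ℂ) * Complex.I))
      ((γ0.prod (Measure.pi fun _ : Fin T => γw)).map (fun z => (C *ᵥ (z.1 - μ0),
      fun i : Fin T =>
        C *ᵥ priorErr A C (kalmanK A C Q S0) (z.1 - μ0) (extFin z.2) (i + 1)))) := by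
    apply Continuous.aestronglyMeasurable; fun_prop
  rw [charFunDual_apply, charFunDual_apply, integral_map hm1.aemeasurable hc,
    integral_map hm2.aemeasurable hc']
  have e2 : ∀ y (x : Fin n → ℝ), (Cᵀ *ᵥ y) ⬝ᵥ x = y ⬝ᵥ C *ᵥ x := by
    intro y x; rw [Matrix.dotProduct_mulVec, Matrix.mulVec_transpose]
  obtain ⟨α, β, h1, h2⟩ := adjoint_lemma A C S0 Q hPt hK a T (Cᵀ *ᵥ a T)
  have l1 : ∀ z : (Fin n → ℝ) × (Fin T → Fin q → ℝ), L (C *ᵥ (z.1 - μ0), z.2) =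
      (Cᵀ *ᵥ a 0) ⬝ᵥ (z.1 - μ0) + ∑ i : Fin T, a (i + 1) ⬝ᵥ z.2 i := by
    intro z
    rw [ha, e2]
  have l2 : ∀ z : (Fin n → ℝ) × (Fin T → Fin n → ℝ), L (C *ᵥ (z.1 - μ0), fun i : Fin T =>
        C *ᵥ priorErr A C (kalmanK A C Q S0) (z.1 - μ0) (extFin z.2) (i + 1)) =
      α ⬝ᵥ (z.1 - μ0) + ∑ i : Fin T, β i ⬝ᵥ z.2 i := by
    intro z
    have h := h1 (z.1 - μ0) (extFin z.2)
    rw [e2, ← Finset.sum_range_succ (fun s => a s ⬝ᵥ C *ᵥ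
      priorErr A C (kalmanK A C Q S0) (z.1 - μ0) (extFin z.2) s), Finset.sum_range_succ',
      Finset.sum_range, Finset.sum_range] at h
    rw [ha, add_comm]
    simpa [extFin, priorErr] using h
  simp_rw [l1, l2]
  rw [prod_char γ0 μ0 S0 hS0.posSemidef hγ0 ν _ (fun i => hM (i + 1)) hν _
      (fun i : Fin T => a (i + 1)),
    prod_char γ0 μ0 S0 hS0.posSemidef hγ0 (fun _ : Fin T => γw) (fun _ => Q)
      (fun i => hQ.posSemidef) (fun _ => hγw) _ (fun i : Fin T => β i)]
  have h3 : (Cᵀ *ᵥ a 0) ⬝ᵥ S0 *ᵥ (Cᵀ *ᵥ a 0) +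
      ∑ i : Fin T, a (i + 1) ⬝ᵥ (C * kalmanPhat A C Q S0 (i + 1) * Cᵀ) *ᵥ a (i + 1) =
      α ⬝ᵥ S0 *ᵥ α + ∑ i : Fin T, β i ⬝ᵥ Q *ᵥ β i := by
    have e4 : ∀ y (P : Matrix (Fin n) (Fin n) ℝ), (Cᵀ *ᵥ y) ⬝ᵥ P *ᵥ (Cᵀ *ᵥ y) =
        y ⬝ᵥ (C * P * Cᵀ) *ᵥ y := by
      intro y P
      rw [e2, Matrix.mulVec_mulVec, Matrix.mulVec_mulVec, Matrix.mul_assoc]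
    rw [e4, ← Finset.sum_range (fun s => Matrix.mulVec Q (β s) |> dotProduct (β s)), h2, e4,
      ← Finset.sum_range_succ (fun s => a s ⬝ᵥ (C * kalmanPhat A C Q S0 s * Cᵀ) *ᵥ a s),
      Finset.sum_range_succ', Finset.sum_range, add_comm]
    simp [kalmanPhat]
  rw [h3]

theorem measurable_mulVec_comp {Ω : Type*} [MeasurableSpace Ω] {a b : ℕ}
    (M : Matrix (Fin a) (Fin b) ℝ) {f : Ω → Fin b → ℝ} (hf : Measurable f) :
    Measurable (fun ω => M *ᵥ f ω) := by
  have : Continuous (fun x : Fin b → ℝ => M *ᵥ x) := by fun_prop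
  exact this.measurable.comp hf

theorem measurable_extFin {T a : ℕ} (t : ℕ) :
    Measurable (fun w : Fin T → Fin a → ℝ => extFin w t) := by
  unfold extFin
  split_ifs
  · exact measurable_pi_apply _
  · exact measurable_const

theorem measurable_priorErr {Ω : Type*} [MeasurableSpace Ω] {n q : ℕ}
    (A : Matrix (Fin n) (Fin n) ℝ)
    (C : Matrix (Fin q) (Fin n) ℝ) (K : ℕ → Matrix (Fin n) (Fin q) ℝ)
    (d0 : Ω → Fin n → ℝ) (w : Ω → ℕ → Fin n → ℝ) (hd : Measurable d0)
    (hw : ∀ t, Measurable (fun ω => w ω t)) (t : ℕ) :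
    Measurable (fun ω => priorErr A C K (d0 ω) (w ω) t) := by
  induction t with
  | zero => exact hd
  | succ t ih =>
    exact (measurable_mulVec_comp A
      (ih.sub (measurable_mulVec_comp _ (measurable_mulVec_comp _ ih)))).add (hw t)

theorem measurable_snoc {Ω : Type*} [MeasurableSpace Ω] {n t : ℕ}
    (f : Ω → Fin t → Fin n → ℝ) (g : Ω → Fin n → ℝ) (hf : Measurable f) (hg : Measurable g) :
    Measurable (fun ω => (Fin.snoc (f ω) (g ω) : Fin (t + 1) → Fin n → ℝ)) := by
  rw [measurable_pi_iff]
  intro i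
  refine Fin.lastCases ?_ (fun j => ?_) i
  · simpa using hg
  · simpa [Function.comp_def] using (measurable_pi_apply j).comp hf

theorem measurable_clHist {Ω : Type*} [MeasurableSpace Ω] {n m : ℕ}
    (A : Matrix (Fin n) (Fin n) ℝ) (B : Matrix (Fin n) (Fin m) ℝ)
    (pol : (t : ℕ) → (Fin (t + 1) → Fin n → ℝ) → Fin m → ℝ) (hp : ∀ t, Measurable (pol t))
    (e : Ω → ℕ → Fin n → ℝ) (ξ : Ω → Fin n → ℝ) (he : ∀ t, Measurable (fun ω => e ω t))
    (hξ : Measurable ξ) (t : ℕ) :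
    Measurable (fun ω => clHist A B pol (e ω) (ξ ω) t) := by
  induction t with
  | zero => exact measurable_pi_iff.2 fun _ => hξ
  | succ t ih =>
    exact measurable_snoc _ _ ih (((measurable_mulVec_comp A
      ((measurable_pi_apply (Fin.last t)).comp ih)).add
        (measurable_mulVec_comp B ((hp t).comp ih))).add (he t))

theorem clHist_apply {n m : ℕ}
    (A : Matrix (Fin n) (Fin n) ℝ) (B : Matrix (Fin n) (Fin m) ℝ)
    (pol : (t : ℕ) → (Fin (t + 1) → Fin n → ℝ) → Fin m → ℝ)
    (e : ℕ → Fin n → ℝ) (ξ : Fin n → ℝ) (t : ℕ) :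
    ∀ i : Fin (t + 1), clHist A B pol e ξ t i = clState A B pol e ξ i := by
  induction t with
  | zero => intro i; rw [show i = Fin.last 0 from Fin.ext (by simp)]; rfl
  | succ t ih =>
    intro i
    refine Fin.lastCases ?_ (fun j => ?_) i
    · rfl
    · rw [clHist, Fin.snoc_castSucc, ih]; rfl

theorem clHist_congr {n m : ℕ}
    (A : Matrix (Fin n) (Fin n) ℝ) (B : Matrix (Fin n) (Fin m) ℝ)
    (pol : (t : ℕ) → (Fin (t + 1) → Fin n → ℝ) → Fin m → ℝ)
    (e e' : ℕ → Fin n → ℝ) (ξ : Fin n → ℝ) (t : ℕ) (h : ∀ s < t, e s = e' s) :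
    clHist A B pol e ξ t = clHist A B pol e' ξ t := by
  induction t with
  | zero => rfl
  | succ t ih =>
    rw [clHist, clHist, ih (fun s hs => h s (by omega)), h t (by omega)]

/-- The Kalman filter estimate history, driven by a state sequence. -/
noncomputable def filtHist {n m q : ℕ} (A : Matrix (Fin n) (Fin n) ℝ)
    (B : Matrix (Fin n) (Fin m) ℝ)
    (C : Matrix (Fin q) (Fin n) ℝ) (K : ℕ → Matrix (Fin n) (Fin q) ℝ) (μ0 : Fin n → ℝ)
    (pol : (t : ℕ) → (Fin (t + 1) → Fin n → ℝ) → Fin m → ℝ)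
    (x : ℕ → Fin n → ℝ) : (t : ℕ) → Fin (t + 1) → Fin n → ℝ
  | 0 => fun _ => μ0 + K 0 *ᵥ (C *ᵥ (x 0 - μ0))
  | t + 1 =>
      Fin.snoc (filtHist A B C K μ0 pol x t)
        (A *ᵥ (filtHist A B C K μ0 pol x t (Fin.last t)) +
          B *ᵥ (pol t (filtHist A B C K μ0 pol x t)) +
          K (t + 1) *ᵥ (C *ᵥ (x (t + 1) - (A *ᵥ (filtHist A B C K μ0 pol x t (Fin.last t)) +
          B *ᵥ (pol t (filtHist A B C K μ0 pol x t))))))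

theorem filtHist_congr {n m q : ℕ} (A : Matrix (Fin n) (Fin n) ℝ)
    (B : Matrix (Fin n) (Fin m) ℝ)
    (C : Matrix (Fin q) (Fin n) ℝ) (K : ℕ → Matrix (Fin n) (Fin q) ℝ) (μ0 : Fin n → ℝ)
    (pol : (t : ℕ) → (Fin (t + 1) → Fin n → ℝ) → Fin m → ℝ)
    (x x' : ℕ → Fin n → ℝ) (t : ℕ) (h : ∀ s ≤ t, x s = x' s) :
    filtHist A B C K μ0 pol x t = filtHist A B C K μ0 pol x' t := by
  induction t with
  | zero => simp only [filtHist, h 0 le_rfl]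
  | succ t ih =>
    rw [filtHist, filtHist, ih (fun s hs => h s (by omega)), h (t + 1) le_rfl]

theorem measurable_filtHist {Ω : Type*} [MeasurableSpace Ω] {n m q : ℕ}
    (A : Matrix (Fin n) (Fin n) ℝ)
    (B : Matrix (Fin n) (Fin m) ℝ)
    (C : Matrix (Fin q) (Fin n) ℝ) (K : ℕ → Matrix (Fin n) (Fin q) ℝ) (μ0 : Fin n → ℝ)
    (pol : (t : ℕ) → (Fin (t + 1) → Fin n → ℝ) → Fin m → ℝ) (hp : ∀ t, Measurable (pol t))
    (x : Ω → ℕ → Fin n → ℝ) (hx : ∀ t, Measurable (fun ω => x ω t)) (t : ℕ) :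
    Measurable (fun ω => filtHist A B C K μ0 pol (x ω) t) := by
  induction t with
  | zero =>
    exact measurable_pi_iff.2 fun _ => measurable_const.add
      (measurable_mulVec_comp _ (measurable_mulVec_comp _ ((hx 0).sub measurable_const)))
  | succ t ih =>
    have h1 := (measurable_mulVec_comp A ((measurable_pi_apply (Fin.last t)).comp ih)).add
        (measurable_mulVec_comp B ((hp t).comp ih))
    exact measurable_snoc _ _ ih (h1.add
      (measurable_mulVec_comp _ (measurable_mulVec_comp _ ((hx (t + 1)).sub h1))))

/-- The refined controller: run the filter on the observed history and apply `Cbar`. -/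
noncomputable def refinedPol {n m q : ℕ} (A : Matrix (Fin n) (Fin n) ℝ)
    (B : Matrix (Fin n) (Fin m) ℝ)
    (C : Matrix (Fin q) (Fin n) ℝ) (K : ℕ → Matrix (Fin n) (Fin q) ℝ) (μ0 : Fin n → ℝ)
    (pol : (t : ℕ) → (Fin (t + 1) → Fin n → ℝ) → Fin m → ℝ)
    (t : ℕ) (h : Fin (t + 1) → Fin n → ℝ) : Fin m → ℝ :=
  pol t (filtHist A B C K μ0 pol (extFin h) t)

theorem coupling {n m q : ℕ} (A : Matrix (Fin n) (Fin n) ℝ)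
    (B : Matrix (Fin n) (Fin m) ℝ)
    (C : Matrix (Fin q) (Fin n) ℝ) (K : ℕ → Matrix (Fin n) (Fin q) ℝ) (μ0 : Fin n → ℝ)
    (pol : (t : ℕ) → (Fin (t + 1) → Fin n → ℝ) → Fin m → ℝ)
    (ξ : Fin n → ℝ) (w : ℕ → Fin n → ℝ) (t : ℕ) :
    filtHist A B C K μ0 pol (clState A B (refinedPol A B C K μ0 pol) w ξ) t =
      clHist A B pol (fun s => K (s + 1) *ᵥ (C *ᵥ priorErr A C K (ξ - μ0) w (s + 1)))
        (μ0 + K 0 *ᵥ (C *ᵥ (ξ - μ0))) t ∧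
    clState A B (refinedPol A B C K μ0 pol) w ξ t =
      clState A B pol (fun s => K (s + 1) *ᵥ (C *ᵥ priorErr A C K (ξ - μ0) w (s + 1)))
        (μ0 + K 0 *ᵥ (C *ᵥ (ξ - μ0))) t +
      (priorErr A C K (ξ - μ0) w t - K t *ᵥ (C *ᵥ priorErr A C K (ξ - μ0) w t)) := by
  induction t with
  | zero =>
    constructor
    · rfl
    · simp [clState, clHist, priorErr]
  | succ t ih =>
    obtain ⟨ih1, ih2⟩ := ih
    set x := clState A B (refinedPol A B C K μ0 pol) w ξ with hx
    set e := fun s => K (s + 1) *ᵥ (C *ᵥ priorErr A C K (ξ - μ0) w (s + 1)) with he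
    set x0 := μ0 + K 0 *ᵥ (C *ᵥ (ξ - μ0)) with hx0
    set d := priorErr A C K (ξ - μ0) w with hd
    have hpol : refinedPol A B C K μ0 pol t (clHist A B (refinedPol A B C K μ0 pol) w ξ t) =
        pol t (clHist A B pol e x0 t) := by
      rw [refinedPol, ← ih1]
      congr 1
      apply filtHist_congr
      intro s hs
      rw [extFin, dif_pos (by omega), clHist_apply]
    have hxs : x (t + 1) = A *ᵥ x t + B *ᵥ pol t (clHist A B pol e x0 t) + w t := by
      rw [← hpol, hx]
      simp [clState, clHist]
    have hxb : clState A B pol e x0 (t + 1) = A *ᵥ clState A B pol e x0 t +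
        B *ᵥ pol t (clHist A B pol e x0 t) + e t := by
      simp [clState, clHist]
    have hds : d (t + 1) = A *ᵥ (d t - K t *ᵥ (C *ᵥ d t)) + w t := rfl
    have hpr : x (t + 1) - (A *ᵥ clState A B pol e x0 t +
        B *ᵥ pol t (clHist A B pol e x0 t)) = d (t + 1) := by
      rw [hxs, hds, ih2, Matrix.mulVec_add]
      abel
    constructor
    · rw [filtHist, ih1, clHist]
      congr 1
      change _ + _ + K (t + 1) *ᵥ (C *ᵥ (x (t + 1) - (A *ᵥ clState A B pol e x0 t +
        B *ᵥ pol t (clHist A B pol e x0 t)))) = _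
      rw [hpr]
    · rw [hxb, ← hpr]
      have : e t = K (t + 1) *ᵥ (C *ᵥ d (t + 1)) := rfl
      rw [this, hpr, ← hpr]
      abel

/-- **Controller refinement (finite-horizon form of Theorem 1 of the paper).** For every
measurable feedback policy `Cbar` for the abstract model (the a posteriori innovation process
`x̄ (t+1) = A * x̄ t + B * ū t + K (t+1) * v (t+1)`, `x̄ 0 = μ₀ + K 0 * C * (ξ - μ₀)`,
`v (t+1) ∼ N(0, C * P̂ (t+1) * Cᵀ)`), there exist measurable policies `pol` for the original
model (`x (t+1) = A * x t + B * u t + w t`, `x 0 = ξ ∼ N(μ₀, Σ₀)`, `w t ∼ N(0, Q)`) such that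
the laws of the output trajectories `(H x̄ 0, …, H x̄ T)` and `(H x 0, …, H x T)`, `H = N * C`,
coincide. -/
theorem controller_refinement {n m q p : ℕ} (hq : 1 ≤ q)
    (A : Matrix (Fin n) (Fin n) ℝ) (B : Matrix (Fin n) (Fin m) ℝ)
    (C : Matrix (Fin q) (Fin n) ℝ) (hC : C.rank = q)
    (N : Matrix (Fin p) (Fin q) ℝ)
    (μ0 : Fin n → ℝ) (S0 Q : Matrix (Fin n) (Fin n) ℝ)
    (hS0 : S0.PosDef) (hQ : Q.PosDef)
    (T : ℕ)
    (γ0 : Measure (Fin n → ℝ)) [IsProbabilityMeasure γ0]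
    (hγ0 : IsGaussianVec γ0 μ0 S0)
    (γw : Measure (Fin n → ℝ)) [IsProbabilityMeasure γw]
    (hγw : IsGaussianVec γw 0 Q)
    (ν : Fin T → Measure (Fin q → ℝ)) [∀ i, IsProbabilityMeasure (ν i)]
    (hν : ∀ i : Fin T, IsGaussianVec (ν i) 0 (C * kalmanPhat A C Q S0 (i.1 + 1) * Cᵀ))
    (Cbar : (t : ℕ) → (Fin (t + 1) → Fin n → ℝ) → Fin m → ℝ)
    (hCbar : ∀ t, Measurable (Cbar t)) :
    ∃ pol : (t : ℕ) → (Fin (t + 1) → Fin n → ℝ) → Fin m → ℝ,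
      (∀ t, Measurable (pol t)) ∧
      (γ0.prod (Measure.pi fun i : Fin T => ν i)).map
          (fun ξv : (Fin n → ℝ) × (Fin T → Fin q → ℝ) =>
            fun i : Fin (T + 1) =>
              (N * C).mulVec
                (clState A B Cbar
                  (fun t => (kalmanK A C Q S0 (t + 1)).mulVec (extFin ξv.2 t))
                  (μ0 + (kalmanK A C Q S0 0).mulVec (C.mulVec (ξv.1 - μ0))) i)) =
        (γ0.prod (Measure.pi fun _ : Fin T => γw)).map
          (fun ξw : (Fin n → ℝ) × (Fin T → Fin n → ℝ) =>
            fun i : Fin (T + 1) =>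
              (N * C).mulVec (clState A B pol (extFin ξw.2) ξw.1 i)) := by
  have hP := phat_facts A C hC S0 Q hS0 hQ
  have hM : ∀ t, (C * kalmanPhat A C Q S0 t * Cᵀ).PosDef := fun t => CPC_posDef C hC _ (hP t)
  have hMu : ∀ t, IsUnit (C * kalmanPhat A C Q S0 t * Cᵀ).det := fun t =>
    (Matrix.isUnit_iff_isUnit_det _).1 (hM t).isUnit
  have hPt : ∀ t, (kalmanPhat A C Q S0 t)ᵀ = kalmanPhat A C Q S0 t := fun t => by
    simpa [Matrix.IsHermitian] using (hP t).1
  have hK : ∀ t, kalmanK A C Q S0 t * (C * kalmanPhat A C Q S0 t * Cᵀ) =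
      kalmanPhat A C Q S0 t * Cᵀ := fun t => by
    rw [kalmanK, Matrix.mul_assoc, Matrix.nonsing_inv_mul _ (hMu t), Matrix.mul_one]
  have hCK : ∀ t, C * kalmanK A C Q S0 t = 1 := fun t => by
    rw [kalmanK, ← Matrix.mul_assoc, ← Matrix.mul_assoc, Matrix.mul_nonsing_inv _ (hMu t)]
  have hm1 : Measurable (fun z : (Fin n → ℝ) × (Fin T → Fin q → ℝ) =>
      (C *ᵥ (z.1 - μ0), z.2)) :=
    (measurable_mulVec_comp C (measurable_fst.sub measurable_const)).prodMk measurable_snd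
  have hm2 : Measurable (fun z : (Fin n → ℝ) × (Fin T → Fin n → ℝ) => (C *ᵥ (z.1 - μ0),
      fun i : Fin T =>
        C *ᵥ priorErr A C (kalmanK A C Q S0) (z.1 - μ0) (extFin z.2) (i + 1))) := by
    refine (measurable_mulVec_comp C (measurable_fst.sub measurable_const)).prodMk
      (measurable_pi_iff.2 fun i => measurable_mulVec_comp C ?_)
    exact measurable_priorErr A C _ (fun z : (Fin n → ℝ) × (Fin T → Fin n → ℝ) => z.1 - μ0)
      (fun z => extFin z.2) (measurable_fst.sub measurable_const)
      (fun t => (measurable_extFin t).comp measurable_snd) _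
  have law := law_innov A C μ0 S0 Q hS0 hQ hPt hK (fun t => (hM t).posSemidef) T γ0 hγ0 γw hγw ν hν
    hm1 hm2
  set G : (Fin q → ℝ) × (Fin T → Fin q → ℝ) → Fin (T + 1) → Fin p → ℝ := fun z i =>
    (N * C) *ᵥ clState A B Cbar (fun t => kalmanK A C Q S0 (t + 1) *ᵥ extFin z.2 t)
      (μ0 + kalmanK A C Q S0 0 *ᵥ z.1) i with hG
  have hGm : Measurable G := by
    refine measurable_pi_iff.2 fun i => measurable_mulVec_comp _ ?_
    exact (measurable_pi_apply (Fin.last (i : ℕ))).comp (measurable_clHist A B Cbar hCbar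
      (fun (z : (Fin q → ℝ) × (Fin T → Fin q → ℝ)) t => kalmanK A C Q S0 (t + 1) *ᵥ extFin z.2 t)
      (fun z => μ0 + kalmanK A C Q S0 0 *ᵥ z.1)
      (fun t => measurable_mulVec_comp _ ((measurable_extFin t).comp measurable_snd))
      (measurable_const.add (measurable_mulVec_comp _ measurable_fst)) i)
  refine ⟨refinedPol A B C (kalmanK A C Q S0) μ0 Cbar, fun t => (hCbar t).comp
    (measurable_filtHist A B C _ μ0 Cbar hCbar (fun h : Fin (t + 1) → Fin n → ℝ => extFin h)
      (fun s => measurable_extFin s) t), ?_⟩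
  have law2 := congrArg (Measure.map G) law
  rw [Measure.map_map hGm hm1, Measure.map_map hGm hm2] at law2
  refine law2.trans ?_
  congr 1
  ext z i : 2
  simp only [hG, Function.comp]
  rw [(coupling A B C (kalmanK A C Q S0) μ0 Cbar z.1 (extFin z.2) i).2, Matrix.mulVec_add]
  have h0 : ∀ y : Fin n → ℝ, (N * C) *ᵥ (y - kalmanK A C Q S0 i *ᵥ (C *ᵥ y)) = 0 := by
    intro y
    rw [← Matrix.mulVec_mulVec, Matrix.mulVec_sub C, Matrix.mulVec_mulVec _ C, hCK,
      Matrix.one_mulVec, sub_self, Matrix.mulVec_zero]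
  rw [h0, add_zero]
  congr 1
  unfold clState
  rw [clHist_congr]
  intro s hs
  rw [extFin, dif_pos (by omega)]
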